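/- Let ι be a type and k : ι → ι → ℝ a symmetric positive semidefinite kernel, i.e., k(z, z′) = k(z′, z) for all z, z′ and for every m ∈ ℕ and every family w : Fin m → ι the Gram matrix (k(w(i), w(j)))_{i,j} is positive semidefinite. Assume moreover k(z, z) ≤ 1 for all z ∈ ι. Let σ_ns > 0, N ∈ ℕ, z : Fin N → ι, and let c > 0. If the posterior variance σ²_q(z(q)) = k(z(q), z(q)) − k_q(z(q))ᵀ (K_q + σ_ns² I)⁻¹ k_q(z(q)) of each queried point conditioned on its predecessors satisfies σ²_q(z(q)) ≥ c for all 0 ≤ q < N, then N · c ≤ (2 / log(1 + σ_ns⁻²)) · (1/2) · log det(I_N + σ_ns⁻² K_N), where K_N is the N×N Gram matrix of z(0), …, z(N−1); in particular N ≤ (2 / (c · log(1 + σ_ns⁻²))) · (1/2) · log det(I_N + σ_ns⁻² K_N). -/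

import Mathlib

open Matrix

/-- A symmetric positive semidefinite kernel: symmetric, and every finite Gram matrix
is positive semidefinite. -/
def IsPSDKernel {ι : Type*} (k : ι → ι → ℝ) : Prop :=
  (∀ z z', k z z' = k z' z) ∧
    ∀ (m : ℕ) (w : Fin m → ι),
      (Matrix.of fun i j : Fin m => k (w i) (w j)).PosSemidef

/-- The Gaussian process posterior variance at a test point `zs`, conditioned on the
points `z 0, …, z (q-1)` with observation noise level `σns`:
`σ²_q(z*) = k(z*,z*) − k_q(z*)ᵀ (K_q + σns² I)⁻¹ k_q(z*)`. -/
noncomputable def postVar {ι : Type*} (k : ι → ι → ℝ) (σns : ℝ)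
    (q : ℕ) (z : Fin q → ι) (zs : ι) : ℝ :=
  k zs zs -
    dotProduct (fun i => k (z i) zs)
      (Matrix.mulVec
        ((Matrix.of (fun i j : Fin q => k (z i) (z j)) +
            σns ^ 2 • (1 : Matrix (Fin q) (Fin q) ℝ))⁻¹)
        (fun i => k (z i) zs))

theorem gp_posDef {ι : Type*} (k : ι → ι → ℝ) (hk : IsPSDKernel k) (s : ℝ) (hs : 0 < s)
    (n : ℕ) (z : Fin n → ι) :
    (Matrix.of (fun i j : Fin n => k (z i) (z j)) +
      s • (1 : Matrix (Fin n) (Fin n) ℝ)).PosDef :=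
  Matrix.PosDef.posSemidef_add (hk.2 n z) (Matrix.PosDef.one.smul hs)

theorem gp_det_succ {ι : Type*} (k : ι → ι → ℝ) (hk : IsPSDKernel k) (σ : ℝ) (hσ : 0 < σ)
    (n : ℕ) (z : Fin (n + 1) → ι) :
    (Matrix.of (fun i j : Fin (n + 1) => k (z i) (z j)) +
      σ ^ 2 • (1 : Matrix (Fin (n + 1)) (Fin (n + 1)) ℝ)).det =
    (Matrix.of (fun i j : Fin n => k (z i.castSucc) (z j.castSucc)) +
      σ ^ 2 • (1 : Matrix (Fin n) (Fin n) ℝ)).det *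
      (σ ^ 2 + postVar k σ n (fun i => z i.castSucc) (z (Fin.last n))) := by
  have hpd := gp_posDef k hk (σ ^ 2) (by positivity) n (fun i => z i.castSucc)
  set A := (Matrix.of (fun i j : Fin n => k (z i.castSucc) (z j.castSucc)) +
      σ ^ 2 • (1 : Matrix (Fin n) (Fin n) ℝ)) with hA
  have hu : IsUnit A := hpd.isUnit
  letI : Invertible A := hu.invertible
  have hb : (Matrix.of (fun i j : Fin (n + 1) => k (z i) (z j)) +
      σ ^ 2 • (1 : Matrix (Fin (n + 1)) (Fin (n + 1)) ℝ)).submatrix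
        (finSumFinEquiv (m := n) (n := 1)) (finSumFinEquiv (m := n) (n := 1)) =
      Matrix.fromBlocks A (Matrix.of fun i _ => k (z i.castSucc) (z (Fin.last n)))
        (Matrix.of fun _ i => k (z i.castSucc) (z (Fin.last n)))
        (Matrix.of fun _ _ => k (z (Fin.last n)) (z (Fin.last n)) + σ ^ 2) := by
    have hl : ∀ j : Fin 1, Fin.natAdd n j = Fin.last n := by
      intro j; ext; simp
    have hc : ∀ j : Fin n, Fin.castAdd 1 j = j.castSucc := fun j => rfl
    ext i j
    rcases i with i | i <;> rcases j with j | j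
    · simp [hA, hc, Matrix.one_apply]
    · simp [hl, hc, Matrix.one_apply, (Fin.castSucc_lt_last i).ne]
    · simp [hl, hc, Matrix.one_apply, (Fin.castSucc_lt_last j).ne']
      exact hk.1 _ _
    · simp [hl, Matrix.one_apply]
  rw [← Matrix.det_submatrix_equiv_self (finSumFinEquiv (m := n) (n := 1)), hb,
    Matrix.det_fromBlocks₁₁, Matrix.invOf_eq_nonsing_inv]
  congr 1
  rw [Matrix.det_fin_one]
  simp only [Matrix.sub_apply, Matrix.of_apply, postVar]
  rw [← hA, Matrix.mul_assoc]
  have : ((Matrix.of fun (_ : Fin 1) i => k (z (Fin.castSucc i)) (z (Fin.last n))) *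
      (A⁻¹ * (Matrix.of fun i (_ : Fin 1) => k (z (Fin.castSucc i)) (z (Fin.last n))))) 0 0 =
      dotProduct (fun i => k (z (Fin.castSucc i)) (z (Fin.last n)))
       (Matrix.mulVec A⁻¹ (fun i => k (z (Fin.castSucc i)) (z (Fin.last n)))) := rfl
  rw [this]
  ring

theorem gp_postVar_le {ι : Type*} (k : ι → ι → ℝ) (hk : IsPSDKernel k) (σ : ℝ) (hσ : 0 < σ)
    (n : ℕ) (z : Fin n → ι) (x : ι) : postVar k σ n z x ≤ k x x := by
  have h := (gp_posDef k hk (σ ^ 2) (by positivity) n z).inv.posSemidef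
  have := h.dotProduct_mulVec_nonneg (fun i => k (z i) x)
  simp only [star_trivial] at this
  unfold postVar
  linarith

theorem gp_log_bound (a v : ℝ) (ha : 0 < a) (h0 : 0 ≤ v) (h1 : v ≤ 1) :
    v * Real.log (1 + a) ≤ Real.log (1 + a * v) := by
  rw [← Real.log_rpow (by positivity)]
  apply Real.log_le_log (by positivity)
  have := rpow_one_add_le_one_add_mul_self (s := a) (by linarith) h0 h1
  linarith

theorem gp_det_scale (n : ℕ) (s : ℝ) (hs : 0 < s) (K : Matrix (Fin n) (Fin n) ℝ) :
    (1 + s⁻¹ • K).det = (s⁻¹) ^ n * (K + s • 1).det := by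
  have : 1 + s⁻¹ • K = s⁻¹ • (K + s • 1) := by
    rw [smul_add, smul_smul, inv_mul_cancel₀ hs.ne', one_smul, add_comm]
  rw [this, Matrix.det_smul, Fintype.card_fin]

theorem gp_main {ι : Type*} (k : ι → ι → ℝ) (hk : IsPSDKernel k)
    (hk1 : ∀ z, k z z ≤ 1) (σ : ℝ) (hσ : 0 < σ) (c : ℝ) (hc : 0 < c) (N : ℕ) :
    ∀ (z : Fin N → ι) (_ : ∀ q : Fin N,
      c ≤ postVar k σ q (fun i : Fin q => z (Fin.castLE q.isLt.le i)) (z q)),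
    (N : ℝ) * c * Real.log (1 + (σ ^ 2)⁻¹) ≤ Real.log
      (((1 : Matrix (Fin N) (Fin N) ℝ) +
        (σ ^ 2)⁻¹ • Matrix.of (fun i j : Fin N => k (z i) (z j))).det) := by
  have hs : 0 < σ ^ 2 := by positivity
  induction N with
  | zero => intro z _; simp
  | succ n ih =>
    intro z hvar
    have h1 := ih (fun i => z i.castSucc) (fun q => hvar q.castSucc)
    have hv : c ≤ postVar k σ n (fun i => z i.castSucc) (z (Fin.last n)) := hvar (Fin.last n)
    have hv1 := (gp_postVar_le k hk σ hσ n (fun i => z i.castSucc) (z (Fin.last n))).trans (hk1 _)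
    have hd := (gp_posDef k hk (σ ^ 2) hs n (fun i => z i.castSucc)).det_pos
    rw [gp_det_scale _ _ hs] at h1 ⊢
    rw [gp_det_succ k hk σ hσ]
    set v := postVar k σ n (fun i => z i.castSucc) (z (Fin.last n))
    set d := (Matrix.of (fun i j : Fin n => k (z i.castSucc) (z j.castSucc)) +
      σ ^ 2 • (1 : Matrix (Fin n) (Fin n) ℝ)).det
    have hv0 : 0 < v := hc.trans_le hv
    have e : ((σ ^ 2)⁻¹) ^ (n + 1) * (d * (σ ^ 2 + v)) =
        (((σ ^ 2)⁻¹) ^ n * d) * (1 + (σ ^ 2)⁻¹ * v) := by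
      have : (σ ^ 2)⁻¹ * σ ^ 2 = 1 := inv_mul_cancel₀ hs.ne'
      rw [pow_succ]
      linear_combination (((σ ^ 2)⁻¹) ^ n * d) * this
    rw [e, Real.log_mul (by positivity) (by positivity)]
    have h2 := gp_log_bound (σ ^ 2)⁻¹ v (by positivity) hv0.le hv1
    have hL : 0 ≤ Real.log (1 + (σ ^ 2)⁻¹) := Real.log_nonneg (by
      have : 0 < (σ ^ 2)⁻¹ := by positivity
      linarith)
    have h3 := mul_le_mul_of_nonneg_right hv hL
    push_cast
    linarith

/-- if every sequentially queried point has posterior variance at least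
`c > 0`, then `N * c` is bounded by `(2 / log (1 + σns⁻²))` times the information gain
`(1/2) log det (I_N + σns⁻² K_N)`; in particular `N` is bounded by
`(2 / (c * log (1 + σns⁻²)))` times the information gain. -/
theorem card_le_of_posterior_variance_lower_bound
    {ι : Type*} (k : ι → ι → ℝ) (hk : IsPSDKernel k)
    (hk1 : ∀ z, k z z ≤ 1)
    (σns : ℝ) (hσ : 0 < σns) (N : ℕ) (z : Fin N → ι)
    (c : ℝ) (hc : 0 < c)
    (hvar : ∀ q : Fin N,
      c ≤ postVar k σns q (fun i : Fin q => z (Fin.castLE q.isLt.le i)) (z q)) :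
    (N : ℝ) * c ≤
      (2 / Real.log (1 + (σns ^ 2)⁻¹)) *
        ((1 / 2) * Real.log
          (((1 : Matrix (Fin N) (Fin N) ℝ) +
              (σns ^ 2)⁻¹ • Matrix.of (fun i j : Fin N => k (z i) (z j))).det)) ∧
    (N : ℝ) ≤
      (2 / (c * Real.log (1 + (σns ^ 2)⁻¹))) *
        ((1 / 2) * Real.log
          (((1 : Matrix (Fin N) (Fin N) ℝ) +
              (σns ^ 2)⁻¹ • Matrix.of (fun i j : Fin N => k (z i) (z j))).det)) := by
  have h := gp_main k hk hk1 σns hσ c hc N z hvar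
  have hL : 0 < Real.log (1 + (σns ^ 2)⁻¹) := Real.log_pos (by
    have : 0 < (σns ^ 2)⁻¹ := by positivity
    linarith)
  set L := Real.log (1 + (σns ^ 2)⁻¹)
  set G := Real.log (((1 : Matrix (Fin N) (Fin N) ℝ) +
              (σns ^ 2)⁻¹ • Matrix.of (fun i j : Fin N => k (z i) (z j))).det)
  constructor
  · have e : 2 / L * (1 / 2 * G) = G / L := by ring
    rw [e, le_div_iff₀ hL]
    exact h
  · have e : 2 / (c * L) * (1 / 2 * G) = G / (c * L) := by ring
    rw [e, le_div_iff₀ (by positivity)]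
    linarith
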